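/- arXiv:2205.06008 — 7 statements merged into one kernel-verified Lean document; each statement's English description precedes it below -/
import Mathlib

section
/- Let n, m : ℕ, let t₀ ≤ t_f be real numbers, let f : ℝⁿ × ℝᵐ × ℝ → ℝⁿ, l : ℝⁿ × ℝᵐ × ℝ → ℝ, l_f : ℝⁿ → ℝ, and let q : ℝⁿ × ℝ → ℝ be (Fréchet) differentiable. Let u : ℝ → ℝᵐ and x : ℝ → ℝⁿ be such that for every t ∈ [t₀, t_f] the map x has derivative f(x(t), u(t), t) at t. Define s(y, v, t) := Dq(y,t)(f(y,v,t), 1) + l(y, v, t), where Dq(y,t) is the Fréchet derivative of q at (y,t), and define s_f(y) := l_f(y) − q(y, t_f). If t ↦ l(x(t), u(t), t) and t ↦ s(x(t), u(t), t) are both interval-integrable on [t₀, t_f], then l_f(x(t_f)) + ∫_{t₀}^{t_f} l(x(t), u(t), t) dt = s_f(x(t_f)) + q(x(t₀), t₀) + ∫_{t₀}^{t_f} s(x(t), u(t), t) dt. -/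
open MeasureTheory

/-- Krotov equivalent-representation theorem. -/
theorem krotov_equivalent_representation
    (n m : ℕ) (t₀ tf : ℝ) (ht : t₀ ≤ tf)
    (f : (Fin n → ℝ) → (Fin m → ℝ) → ℝ → (Fin n → ℝ))
    (l : (Fin n → ℝ) → (Fin m → ℝ) → ℝ → ℝ)
    (lf : (Fin n → ℝ) → ℝ)
    (q : ((Fin n → ℝ) × ℝ) → ℝ) (hq : Differentiable ℝ q)
    (x : ℝ → (Fin n → ℝ)) (u : ℝ → (Fin m → ℝ))
    (hx : ∀ t ∈ Set.Icc t₀ tf, HasDerivAt x (f (x t) (u t) t) t)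
    (s : (Fin n → ℝ) → (Fin m → ℝ) → ℝ → ℝ)
    (hs : ∀ y v t, s y v t = fderiv ℝ q (y, t) (f y v t, 1) + l y v t)
    (sf : (Fin n → ℝ) → ℝ)
    (hsf : ∀ y, sf y = lf y - q (y, tf))
    (hl : IntervalIntegrable (fun t => l (x t) (u t) t) volume t₀ tf)
    (hsi : IntervalIntegrable (fun t => s (x t) (u t) t) volume t₀ tf) :
    lf (x tf) + ∫ t in t₀..tf, l (x t) (u t) t =
      sf (x tf) + q (x t₀, t₀) + ∫ t in t₀..tf, s (x t) (u t) t := by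
  have hderiv : ∀ t ∈ Set.uIcc t₀ tf, HasDerivAt (fun t => q (x t, t))
      (s (x t) (u t) t - l (x t) (u t) t) t := by
    intro t hmem
    rw [Set.uIcc_of_le ht] at hmem
    have hcurve := (hx t hmem).prodMk (hasDerivAt_id t)
    have hcomp := HasFDerivAt.comp_hasDerivAt (f := fun t => (x t, id t)) t
      (hq (x t, t)).hasFDerivAt hcurve
    simpa [hs, Function.comp_def] using hcomp
  have hint := intervalIntegral.integral_eq_sub_of_hasDerivAt hderiv (hsi.sub hl)
  rw [intervalIntegral.integral_sub hsi hl] at hint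
  rw [hsf]
  linarith
end

section
/- Let n, m : ℕ, let t₀ ≤ t_f be real numbers, let f : ℝⁿ × ℝᵐ × ℝ → ℝⁿ, l : ℝⁿ × ℝᵐ × ℝ → ℝ, l_f : ℝⁿ → ℝ, and let q : ℝⁿ × ℝ → ℝ be (Fréchet) differentiable. Define s(y, v, t) := Dq(y,t)(f(y,v,t), 1) + l(y, v, t) and s_f(y) := l_f(y) − q(y, t_f). Let (x, u) and (x*, u*) be two pairs of maps x, x* : ℝ → ℝⁿ, u, u* : ℝ → ℝᵐ such that for every t ∈ [t₀, t_f], x has derivative f(x(t), u(t), t) at t and x* has derivative f(x*(t), u*(t), t) at t, and such that t ↦ l(x(t),u(t),t), t ↦ s(x(t),u(t),t), t ↦ l(x*(t),u*(t),t), and t ↦ s(x*(t),u*(t),t) are all interval-integrable on [t₀, t_f]. Assume moreover that x(t₀) = x*(t₀), that for every t ∈ [t₀, t_f] and every (y, v) ∈ ℝⁿ × ℝᵐ one has s(x*(t), u*(t), t) ≤ s(y, v, t), and that for every y ∈ ℝⁿ one has s_f(x*(t_f)) ≤ s_f(y). Then l_f(x*(t_f)) + ∫_{t₀}^{t_f}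 l(x*(t), u*(t), t) dt ≤ l_f(x(t_f)) + ∫_{t₀}^{t_f} l(x(t), u(t), t) dt. -/
open MeasureTheory

/-- The chain rule and the fundamental theorem of calculus for `t ↦ q (x t, t)` along a curve,
with the integrand written as a difference of two integrable functions. -/
theorem integral_sub_integral_eq_sub_of_fderiv_along_curve
    {E : Type*} [NormedAddCommGroup E] [NormedSpace ℝ E] {a b : ℝ}
    {q : E × ℝ → ℝ} (hq : Differentiable ℝ q) {x x' : ℝ → E} {g h : ℝ → ℝ}
    (hx : ∀ t ∈ Set.uIcc a b, HasDerivAt x (x' t) t)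
    (hgh : ∀ t, g t = fderiv ℝ q (x t, t) (x' t, 1) + h t)
    (hg : IntervalIntegrable g volume a b) (hh : IntervalIntegrable h volume a b) :
    (∫ t in a..b, g t) - ∫ t in a..b, h t = q (x b, b) - q (x a, a) := by
  rw [← intervalIntegral.integral_sub hg hh]
  refine intervalIntegral.integral_eq_sub_of_hasDerivAt (f := fun t => q (x t, t))
    (fun t ht => ?_) (hg.sub hh)
  rw [hgh, add_sub_cancel_right]
  exact (hq (x t, t)).hasFDerivAt.comp_hasDerivAt (f := fun t => (x t, t)) t
    ((hx t ht).prodMk (hasDerivAt_id' t))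

/-- Krotov sufficient conditions for global optimality. -/
theorem krotov_sufficient_conditions
    (n m : ℕ) (t₀ tf : ℝ) (ht : t₀ ≤ tf)
    (f : (Fin n → ℝ) → (Fin m → ℝ) → ℝ → (Fin n → ℝ))
    (l : (Fin n → ℝ) → (Fin m → ℝ) → ℝ → ℝ)
    (lf : (Fin n → ℝ) → ℝ)
    (q : ((Fin n → ℝ) × ℝ) → ℝ) (hq : Differentiable ℝ q)
    (s : (Fin n → ℝ) → (Fin m → ℝ) → ℝ → ℝ)
    (hs : ∀ y v t, s y v t = fderiv ℝ q (y, t) (f y v t, 1) + l y v t)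
    (sf : (Fin n → ℝ) → ℝ)
    (hsf : ∀ y, sf y = lf y - q (y, tf))
    (x : ℝ → (Fin n → ℝ)) (u : ℝ → (Fin m → ℝ))
    (xs : ℝ → (Fin n → ℝ)) (us : ℝ → (Fin m → ℝ))
    (hx : ∀ t ∈ Set.Icc t₀ tf, HasDerivAt x (f (x t) (u t) t) t)
    (hxs : ∀ t ∈ Set.Icc t₀ tf, HasDerivAt xs (f (xs t) (us t) t) t)
    (hl : IntervalIntegrable (fun t => l (x t) (u t) t) volume t₀ tf)
    (hsi : IntervalIntegrable (fun t => s (x t) (u t) t) volume t₀ tf)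
    (hls : IntervalIntegrable (fun t => l (xs t) (us t) t) volume t₀ tf)
    (hsis : IntervalIntegrable (fun t => s (xs t) (us t) t) volume t₀ tf)
    (h0 : x t₀ = xs t₀)
    (hmin : ∀ t ∈ Set.Icc t₀ tf, ∀ (y : Fin n → ℝ) (v : Fin m → ℝ),
      s (xs t) (us t) t ≤ s y v t)
    (hminf : ∀ y : Fin n → ℝ, sf (xs tf) ≤ sf y) :
    lf (xs tf) + ∫ t in t₀..tf, l (xs t) (us t) t ≤
      lf (x tf) + ∫ t in t₀..tf, l (x t) (u t) t := by
  have hIcc := Set.uIcc_of_le ht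
  have key := integral_sub_integral_eq_sub_of_fderiv_along_curve hq
    (by rwa [hIcc]) (fun t => hs (x t) (u t) t) hsi hl
  have keys := integral_sub_integral_eq_sub_of_fderiv_along_curve hq
    (by rwa [hIcc]) (fun t => hs (xs t) (us t) t) hsis hls
  have hmono := intervalIntegral.integral_mono_on ht hsis hsi
    (fun t htI => hmin t htI (x t) (u t))
  have hfinal := hminf (x tf)
  rw [hsf, hsf] at hfinal
  rw [h0] at key
  linarith
end

section
/- Let n, m : ℕ, A ∈ ℝ^{n×n}, B ∈ ℝ^{n×m}, let Q ∈ ℝ^{n×n} be symmetric positive semidefinite, let R ∈ ℝ^{m×m} be symmetric positive definite, and let P ∈ ℝ^{n×n} be arbitrary; set S := P + Pᵀ. Define s : ℝⁿ × ℝᵐ → ℝ by s(x, u) := xᵀ S (A x + B u) + xᵀ Q x + uᵀ R u. Then s is strictly convex on ℝⁿ × ℝᵐ if and only if the symmetric block matrix [[(1/2)(Aᵀ S + S A) + Q, S B], [Bᵀ S, 4 R]] is positive definite. (Note that xᵀ(1/2)(AᵀS+SA)x = xᵀ(AᵀP+PA)x for all x, so when P is symmetric this block matrix equals the paper's matrix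 [[AᵀP+PA+Q, (P+Pᵀ)B],[Bᵀ(P+Pᵀ), 4R]].) -/
open Matrix

namespace QuadraticMap

variable {E : Type*} [AddCommGroup E] [Module ℝ E]

/-- The defect of convexity of a real quadratic form along a segment. -/
theorem map_convexCombo (q : QuadraticForm ℝ E) (x y : E) {a b : ℝ} (hab : a + b = 1) :
    q (a • x + b • y) = a * q x + b * q y - a * b * q (x - y) := by
  have hsub : q (x - y) = q x + q y - polar q x y := by
    rw [sub_eq_add_neg, QuadraticMap.map_add q, QuadraticMap.map_neg, polar_neg_right]
    ring
  rw [QuadraticMap.map_add q, QuadraticMap.map_smul, QuadraticMap.map_smul, polar_smul_left,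
    polar_smul_right, hsub]
  obtain rfl : b = 1 - a := by linarith
  simp only [smul_eq_mul]
  ring

theorem strictConvexOn_univ_iff_posDef (q : QuadraticForm ℝ E) :
    StrictConvexOn ℝ Set.univ q ↔ q.PosDef := by
  refine ⟨fun h z hz => ?_, fun h => ⟨convex_univ, fun x _ y _ hxy a b ha hb hab => ?_⟩⟩
  · have hlt := h.2 (Set.mem_univ z) (Set.mem_univ 0) hz
      (show (0 : ℝ) < 1 / 2 by norm_num) (show (0 : ℝ) < 1 / 2 by norm_num) (by norm_num)
    rw [map_convexCombo q z 0 (by norm_num), sub_zero] at hlt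
    simp only [smul_eq_mul] at hlt
    linarith
  · rw [map_convexCombo q x y hab]
    have := mul_pos (mul_pos ha hb) (h (x - y) (sub_ne_zero.mpr hxy))
    simp only [smul_eq_mul]
    linarith

end QuadraticMap

/-- Strict convexity of the Krotov integrand for the LQR problem is equivalent to
positive definiteness of the associated block matrix. -/
theorem strict_convexity_iff_block_posdef
    (n m : ℕ)
    (A : Matrix (Fin n) (Fin n) ℝ) (B : Matrix (Fin n) (Fin m) ℝ)
    (Q : Matrix (Fin n) (Fin n) ℝ) (R : Matrix (Fin m) (Fin m) ℝ)
    (hQ : Q.PosSemidef) (hR : R.PosDef)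
    (P : Matrix (Fin n) (Fin n) ℝ)
    (S : Matrix (Fin n) (Fin n) ℝ) (hS : S = P + Pᵀ)
    (s : ((Fin n → ℝ) × (Fin m → ℝ)) → ℝ)
    (hs : ∀ xu : (Fin n → ℝ) × (Fin m → ℝ),
      s xu = xu.1 ⬝ᵥ (S *ᵥ (A *ᵥ xu.1 + B *ᵥ xu.2)) + xu.1 ⬝ᵥ (Q *ᵥ xu.1)
        + xu.2 ⬝ᵥ (R *ᵥ xu.2)) :
    StrictConvexOn ℝ Set.univ s ↔
      (Matrix.fromBlocks ((1/2 : ℝ) • (Aᵀ * S + S * A) + Q) (S * B)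
        (Bᵀ * S) ((4 : ℝ) • R)).PosDef := by
  have hST : Sᵀ = S := by rw [hS, transpose_add, transpose_transpose, add_comm]
  have hQT : Qᵀ = Q := by simpa [conjTranspose_eq_transpose_of_trivial] using hQ.isHermitian.eq
  have hRT : Rᵀ = R := by simpa [conjTranspose_eq_transpose_of_trivial] using hR.isHermitian.eq
  set N := Matrix.fromBlocks ((1/2 : ℝ) • (Aᵀ * S + S * A) + Q) (S * B)
    (Bᵀ * S) ((4 : ℝ) • R) with hN
  have hNH : N.IsHermitian := by
    rw [IsHermitian, conjTranspose_eq_transpose_of_trivial, hN, fromBlocks_transpose]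
    simp [hST, hQT, hRT, add_comm]
  let e : ((Fin n → ℝ) × (Fin m → ℝ)) ≃ₗ[ℝ] (Fin n ⊕ Fin m → ℝ) :=
    ((LinearEquiv.refl ℝ (Fin n → ℝ)).prodCongr
      (LinearEquiv.smulOfNeZero ℝ (Fin m → ℝ) (1 / 2 : ℝ) (by norm_num))).trans
      (LinearEquiv.sumArrowLequivProdArrow (Fin n) (Fin m) ℝ ℝ).symm
  have he : ∀ xu, e xu = Sum.elim xu.1 ((1 / 2 : ℝ) • xu.2) := by
    intro xu
    ext (i | i) <;> simp [e]
  have hsN : ∀ xu, s xu = e xu ⬝ᵥ N *ᵥ e xu := by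
    rintro ⟨x, u⟩
    have hA : x ⬝ᵥ (Aᵀ * S) *ᵥ x = x ⬝ᵥ (S * A) *ᵥ x := by
      rw [dotProduct_mulVec, ← mulVec_transpose, dotProduct_comm, transpose_mul, hST,
        transpose_transpose]
    have hB : u ⬝ᵥ (Bᵀ * S) *ᵥ x = x ⬝ᵥ (S * B) *ᵥ u := by
      rw [dotProduct_mulVec, ← mulVec_transpose, dotProduct_comm, transpose_mul, hST,
        transpose_transpose]
    rw [hs, he, hN, fromBlocks_mulVec, sumElim_dotProduct_sumElim]
    simp only [Sum.elim_comp_inl, Sum.elim_comp_inr, mulVec_add, add_mulVec, smul_mulVec,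
      mulVec_smul, dotProduct_add, dotProduct_smul, smul_dotProduct, hA, hB, mulVec_mulVec,
      smul_eq_mul]
    ring
  let q : QuadraticForm ℝ ((Fin n → ℝ) × (Fin m → ℝ)) :=
    N.toQuadraticForm'.comp e.toLinearMap
  have hq : s = q := by
    ext xu
    simp [hsN, q, Matrix.toQuadraticForm', toLinearMap₂'_apply']
  rw [hq, QuadraticMap.strictConvexOn_univ_iff_posDef, posDef_iff_dotProduct_mulVec]
  simp only [hNH, true_and, star_trivial]
  refine ⟨fun h z hz => ?_, fun h z hz => ?_⟩
  · have := h (e.symm z) (by simpa using hz)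
    rwa [← hq, hsN, e.apply_symm_apply] at this
  · rw [← hq, hsN]
    exact h (by simpa using hz)
end

section
/- Let n, m : ℕ, A ∈ ℝ^{n×n}, B ∈ ℝ^{n×m}, let Q ∈ ℝ^{n×n} be symmetric positive semidefinite, let R ∈ ℝ^{m×m} be symmetric positive definite, and let P ∈ ℝ^{n×n}. Set S := P + Pᵀ, Ξ := B R⁻¹ Bᵀ, and A_cl := A − (1/2) Ξ S. Assume: (i) A_cl is Hurwitz; (ii) P̄ ∈ ℝ^{n×n} is symmetric positive definite and the symmetric block matrix [[−(Aᵀ P̄ + P̄ A + Q), (S − 2P̄) B], [Bᵀ (S − 2P̄), 4 R]] is positive definite; (iii) Y ∈ ℝ^{n×n} is symmetric and satisfies A_clᵀ Y + Y A_cl + Q + (1/4) S Ξ S = 0. Then P̄ − Y is positive definite; in particular, x₀ᵀ Y x₀ < x₀ᵀ P̄ x₀ for every x₀ ≠ 0. -/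
open Matrix

/-- If a positive definite `P` satisfies `Mᵀ P + P M ≤ 0`, then every symmetric `X` with
`Mᵀ X + X M < 0` is positive definite. -/
theorem posDef_of_lyapunov_of_posDef {n : Type*} [Fintype n] {M P X : Matrix n n ℝ}
    (hX : X.IsHermitian) (hP : P.PosDef)
    (hPM : (-(Mᵀ * P + P * M)).PosSemidef) (hXM : (-(Mᵀ * X + X * M)).PosDef) :
    X.PosDef := by
  refine PosDef.of_dotProduct_mulVec_pos hX fun y hy => ?_
  simp only [star_trivial]
  have hPpos : ∀ x : n → ℝ, x ≠ 0 → 0 < x ⬝ᵥ P *ᵥ x := fun x hx => by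
    simpa using hP.dotProduct_mulVec_pos hx
  set f : (n → ℝ) → ℝ := fun x => (x ⬝ᵥ X *ᵥ x) / (x ⬝ᵥ P *ᵥ x) with hf
  have hscale : ∀ (c : ℝ) (x : n → ℝ), c ≠ 0 → f (c • x) = f x := fun c x hc => by
    simp only [hf, mulVec_smul, dotProduct_smul, smul_dotProduct, smul_eq_mul]
    rw [mul_div_mul_left _ _ hc, mul_div_mul_left _ _ hc]
  have hne : ∀ x ∈ Metric.sphere (0 : n → ℝ) 1, x ≠ 0 := fun x hx =>
    ne_zero_of_mem_unit_sphere ⟨x, hx⟩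
  have hnormalize : ∀ x : n → ℝ, x ≠ 0 → ‖x‖⁻¹ • x ∈ Metric.sphere (0 : n → ℝ) 1 :=
    fun x hx => by simp [norm_smul, hx]
  obtain ⟨z, hz, hmin⟩ := (isCompact_sphere (0 : n → ℝ) 1).exists_isMinOn
    ⟨_, hnormalize y hy⟩ (f := f) (ContinuousOn.div (by fun_prop) (by fun_prop)
      fun x hx => (hPpos x (hne x hx)).ne')
  have hz0 := hne z hz
  have hle : ∀ x : n → ℝ, x ≠ 0 → f z * (x ⬝ᵥ P *ᵥ x) ≤ x ⬝ᵥ X *ᵥ x := fun x hx => by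
    have h := isMinOn_iff.1 hmin _ (hnormalize x hx)
    rw [hscale _ _ (inv_ne_zero (norm_ne_zero_iff.2 hx))] at h
    exact (le_div_iff₀ (hPpos x hx)).1 h
  rcases lt_or_ge 0 (f z) with hpos | hneg
  · exact (mul_pos hpos (hPpos y hy)).trans_le (hle y hy)
  exfalso
  have hpsd : (X - f z • P).PosSemidef := by
    refine PosSemidef.of_dotProduct_mulVec_nonneg (hX.sub ?_) fun x => ?_
    · exact hP.isHermitian.smul (IsSelfAdjoint.all _)
    · rcases eq_or_ne x 0 with rfl | hx
      · simp
      · simpa [sub_mulVec, smul_mulVec] using hle x hx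
  have hker : (X - f z • P) *ᵥ z = 0 := by
    refine (hpsd.dotProduct_mulVec_zero_iff z).1 ?_
    simp [sub_mulVec, smul_mulVec, hf, (hPpos z hz0).ne']
  have hker' : z ᵥ* (X - f z • P) = 0 := by
    rw [← mulVec_transpose, ← conjTranspose_eq_transpose_of_trivial, hpsd.isHermitian.eq, hker]
  have hzero : z ⬝ᵥ (Mᵀ * (X - f z • P) + (X - f z • P) * M) *ᵥ z = 0 := by
    rw [add_mulVec, dotProduct_add, ← mulVec_mulVec, ← mulVec_mulVec, hker,
      dotProduct_mulVec z (X - f z • P), hker']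
    simp
  have hsplit : Mᵀ * (X - f z • P) + (X - f z • P) * M
      = f z • -(Mᵀ * P + P * M) - -(Mᵀ * X + X * M) := by
    simp only [Matrix.mul_sub, Matrix.sub_mul, Matrix.mul_smul, Matrix.smul_mul]
    module
  rw [hsplit, sub_mulVec, smul_mulVec, dotProduct_sub, dotProduct_smul, smul_eq_mul] at hzero
  have h1 : 0 < z ⬝ᵥ -(Mᵀ * X + X * M) *ᵥ z := by simpa using hXM.dotProduct_mulVec_pos hz0
  have h2 : 0 ≤ z ⬝ᵥ -(Mᵀ * P + P * M) *ᵥ z := by simpa using hPM.dotProduct_mulVec_nonneg z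
  nlinarith [mul_nonneg (neg_nonneg.2 hneg) h2]

/-- The Schur complement of the lower right block of a positive definite block matrix is
positive definite. -/
theorem Matrix.PosDef.schurComplement₂₂ {m n : Type*} [Fintype m] [Fintype n] [DecidableEq n]
    {A : Matrix m m ℝ} {B : Matrix m n ℝ} {C : Matrix n m ℝ} {D : Matrix n n ℝ}
    (h : (fromBlocks A B C D).PosDef) (hD : D.PosDef) :
    (A - B * D⁻¹ * C).PosDef := by
  have hC : C = Bᴴ := (isHermitian_fromBlocks_iff.1 h.isHermitian).2.1.symm
  have hDdet : IsUnit D.det := (isUnit_iff_isUnit_det D).1 hD.isUnit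
  subst hC
  refine PosDef.of_dotProduct_mulVec_pos
    ((IsHermitian.fromBlocks₂₂ A B hD.isHermitian).1 h.isHermitian) fun x hx => ?_
  have := h.dotProduct_mulVec_pos (x := Sum.elim x (-(D⁻¹ * Bᴴ) *ᵥ x))
    fun h0 => hx (funext fun i => congrFun h0 (Sum.inl i))
  have hlow : Bᴴ *ᵥ x + D *ᵥ (-(D⁻¹ * Bᴴ) *ᵥ x) = 0 := by
    rw [mulVec_mulVec, Matrix.mul_neg, mul_nonsing_inv_cancel_left _ _ hDdet, neg_mulVec,
      add_neg_cancel]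
  simp only [star_trivial] at this ⊢
  rw [fromBlocks_mulVec, Sum.elim_comp_inl, Sum.elim_comp_inr, hlow,
    sumElim_dotProduct_sumElim, dotProduct_zero, add_zero] at this
  rwa [mulVec_mulVec, Matrix.mul_neg, ← Matrix.mul_assoc, neg_mulVec, ← sub_eq_add_neg,
    ← sub_mulVec] at this

/-- The paper's Proposition 5: suboptimality bound for the stable-case
ε-suboptimal LQR design. -/
theorem suboptimal_lqr_bound_stable
    (n m : ℕ)
    (A : Matrix (Fin n) (Fin n) ℝ) (B : Matrix (Fin n) (Fin m) ℝ)
    (Q : Matrix (Fin n) (Fin n) ℝ) (R : Matrix (Fin m) (Fin m) ℝ)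
    (hQ : Q.PosSemidef) (hR : R.PosDef)
    (P : Matrix (Fin n) (Fin n) ℝ)
    (S : Matrix (Fin n) (Fin n) ℝ) (hS : S = P + Pᵀ)
    (Ξ : Matrix (Fin n) (Fin n) ℝ) (hΞ : Ξ = B * R⁻¹ * Bᵀ)
    (Acl : Matrix (Fin n) (Fin n) ℝ) (hAcl : Acl = A - (1/2 : ℝ) • (Ξ * S))
    (hHurwitz : ∀ μ ∈ spectrum ℂ (Acl.map ((↑) : ℝ → ℂ)), μ.re < 0)
    (Pbar : Matrix (Fin n) (Fin n) ℝ) (hPbar : Pbar.PosDef)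
    (hLMI : (Matrix.fromBlocks (-(Aᵀ * Pbar + Pbar * A + Q)) ((S - (2:ℝ) • Pbar) * B)
      (Bᵀ * (S - (2:ℝ) • Pbar)) ((4:ℝ) • R)).PosDef)
    (Y : Matrix (Fin n) (Fin n) ℝ) (hYsymm : Yᵀ = Y)
    (hYlyap : Aclᵀ * Y + Y * Acl + Q + (1/4 : ℝ) • (S * Ξ * S) = 0) :
    (Pbar - Y).PosDef ∧
    ∀ x₀ : Fin n → ℝ, x₀ ≠ 0 → x₀ ⬝ᵥ (Y *ᵥ x₀) < x₀ ⬝ᵥ (Pbar *ᵥ x₀) := by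
  have hRi : R⁻¹.PosSemidef := hR.inv.posSemidef
  have hS' : Sᵀ = S := by rw [hS, transpose_add, transpose_transpose, add_comm]
  have hPt : Pbarᵀ = Pbar := by simpa using hPbar.isHermitian.eq
  have hΞt : Ξᵀ = Ξ := by
    have hRt : R⁻¹ᵀ = R⁻¹ := by simpa using hRi.isHermitian.eq
    rw [hΞ, transpose_mul, transpose_mul, transpose_transpose, hRt, Matrix.mul_assoc]
  have hΞpsd : Ξ.PosSemidef := by
    simpa [hΞ] using hRi.mul_mul_conjTranspose_same B
  have hPΞP : (Pbar * Ξ * Pbar).PosSemidef := by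
    simpa [hPt] using hΞpsd.mul_mul_conjTranspose_same Pbar
  have hSΞS : (S * Ξ * S).PosSemidef := by
    simpa [hS'] using hΞpsd.mul_mul_conjTranspose_same S
  have hSchur := hLMI.schurComplement₂₂ (hR.smul (by norm_num : (0 : ℝ) < 4))
  have hinv : ((4 : ℝ) • R)⁻¹ = (1 / 4 : ℝ) • R⁻¹ := by
    have hRdet : IsUnit R.det := (isUnit_iff_isUnit_det R).1 hR.isUnit
    refine inv_eq_right_inv ?_
    rw [Matrix.smul_mul, Matrix.mul_smul, mul_nonsing_inv _ hRdet, smul_smul]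
    norm_num
  have hcross : (S - (2 : ℝ) • Pbar) * B * ((4 : ℝ) • R)⁻¹ * (Bᵀ * (S - (2 : ℝ) • Pbar))
      = (1 / 4 : ℝ) • ((S - (2 : ℝ) • Pbar) * Ξ * (S - (2 : ℝ) • Pbar)) := by
    rw [hinv, hΞ]
    simp only [Matrix.mul_smul, Matrix.smul_mul, Matrix.mul_assoc]
  rw [hcross] at hSchur
  have hW : (-(Aclᵀ * (Pbar - Y) + (Pbar - Y) * Acl)).PosDef := by
    convert hSchur.add_posSemidef hPΞP using 1
    have hYl : Aclᵀ * Y + Y * Acl = -(Q + (1/4 : ℝ) • (S * Ξ * S)) := by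
      rw [eq_neg_iff_add_eq_zero, ← add_assoc, hYlyap]
    have : -(Aclᵀ * (Pbar - Y) + (Pbar - Y) * Acl)
        = (Aclᵀ * Y + Y * Acl) - (Aclᵀ * Pbar + Pbar * Acl) := by
      simp only [Matrix.mul_sub, Matrix.sub_mul]; abel
    rw [this, hYl, hAcl]
    simp only [transpose_sub, transpose_smul, transpose_mul, hS', hΞt, Matrix.mul_sub,
      Matrix.sub_mul, Matrix.mul_smul, Matrix.smul_mul, Matrix.mul_assoc]
    module
  have hV : (-(Aclᵀ * Pbar + Pbar * Acl)).PosSemidef := by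
    convert (hW.posSemidef.add hQ).add (hSΞS.smul (by norm_num : (0 : ℝ) ≤ 1 / 4)) using 1
    have : -(Aclᵀ * (Pbar - Y) + (Pbar - Y) * Acl) + Q + (1 / 4 : ℝ) • (S * Ξ * S)
        = -(Aclᵀ * Pbar + Pbar * Acl)
          + (Aclᵀ * Y + Y * Acl + Q + (1/4 : ℝ) • (S * Ξ * S)) := by
      simp only [Matrix.mul_sub, Matrix.sub_mul]; abel
    rw [this, hYlyap, add_zero]
  have hpos : (Pbar - Y).PosDef :=
    posDef_of_lyapunov_of_posDef (hPbar.isHermitian.sub (by simpa [IsHermitian] using hYsymm))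
      hPbar hV hW
  refine ⟨hpos, fun x hx => ?_⟩
  simpa [sub_mulVec] using hpos.dotProduct_mulVec_pos hx
end

section
/- Let n, m : ℕ, A ∈ ℝ^{n×n}, B ∈ ℝ^{n×m}, let Q ∈ ℝ^{n×n} be symmetric positive semidefinite and R ∈ ℝ^{m×m} symmetric positive definite. Then the following are equivalent: (a) there exist a matrix P ∈ ℝ^{n×n} and a symmetric positive definite matrix P̄ ∈ ℝ^{n×n} such that the symmetric block matrix [[−(Aᵀ P̄ + P̄ A + Q), (P + Pᵀ − 2P̄) B], [Bᵀ (P + Pᵀ − 2P̄), 4 R]] is positive definite; (b) A is Hurwitz. -/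
open Matrix

open Filter Topology in
theorem summable_norm_pow_of_spectralRadius_lt_one {𝔸 : Type*} [NormedRing 𝔸]
    [NormedAlgebra ℂ 𝔸] [CompleteSpace 𝔸] {a : 𝔸} (ha : spectralRadius ℂ a < 1) :
    Summable fun k : ℕ => ‖a ^ k‖ := by
  obtain ⟨r, hr₁, hr₂⟩ := ENNReal.lt_iff_exists_nnreal_btwn.1 ha
  refine summable_of_isBigO_nat (summable_geometric_of_lt_one r.2 (by exact_mod_cast hr₂))
    (Asymptotics.IsBigO.of_bound 1 ?_)
  filter_upwards [(spectrum.pow_nnnorm_pow_one_div_tendsto_nhds_spectralRadius a).eventually_lt_const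
    hr₁, eventually_gt_atTop 0] with k hk hk₀
  have hk' : (0 : ℝ) < k := by exact_mod_cast hk₀
  have h := ENNReal.rpow_le_rpow hk.le hk'.le
  rw [← ENNReal.rpow_mul, one_div_mul_cancel hk'.ne', ENNReal.rpow_one, ENNReal.rpow_natCast] at h
  have h' : ‖a ^ k‖₊ ≤ r ^ k := by exact_mod_cast h
  simpa using (show ‖a ^ k‖ ≤ (r : ℝ) ^ k from by exact_mod_cast h')

namespace Matrix

section Stein

attribute [local instance] frobeniusNormedAddCommGroup frobeniusNormedSpace frobeniusNormedRing
  frobeniusNormedAlgebra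

variable {n : Type*} [Fintype n] [DecidableEq n]

theorem summable_norm_pow_of_spectrum_lt_one {C : Matrix n n ℝ}
    (hC : ∀ z ∈ spectrum ℂ (C.map ((↑) : ℝ → ℂ)), ‖z‖ < 1) :
    Summable fun k : ℕ => ‖C ^ k‖ := by
  have : CompleteSpace (Matrix n n ℂ) := FiniteDimensional.complete ℂ _
  have hr : spectralRadius ℂ (C.map ((↑) : ℝ → ℂ)) < 1 := by
    cases isEmpty_or_nonempty n
    · simp [spectrum.SpectralRadius.of_subsingleton]
    · exact spectrum.spectralRadius_lt_of_forall_lt (r := 1) _ fun z hz => hC z hz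
  convert summable_norm_pow_of_spectralRadius_lt_one hr using 2 with k
  rw [show C.map ((↑) : ℝ → ℂ) ^ k = (C ^ k).map ((↑) : ℝ → ℂ) from
    (Matrix.map_pow C Complex.ofRealHom k).symm]
  exact (frobenius_norm_map_eq _ _ fun a => by simp).symm

/-- Solvability of the discrete-time Lyapunov (Stein) equation. -/
theorem exists_posDef_sub_transpose_mul_mul_eq {C S : Matrix n n ℝ}
    (hC : ∀ z ∈ spectrum ℂ (C.map ((↑) : ℝ → ℂ)), ‖z‖ < 1) (hS : S.PosDef) :
    ∃ P : Matrix n n ℝ, P.PosDef ∧ P - Cᵀ * P * C = S := by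
  have : CompleteSpace (Matrix n n ℝ) := FiniteDimensional.complete ℝ _
  set f : ℕ → Matrix n n ℝ := fun k => (C ^ k)ᵀ * S * C ^ k with hf
  have hpow := summable_norm_pow_of_spectrum_lt_one hC
  have hsum : Summable f := by
    refine .of_norm_bounded_eventually_nat (g := fun k => ‖S‖ * ‖C ^ k‖) (hpow.mul_left _) ?_
    filter_upwards [hpow.tendsto_atTop_zero.eventually_le_const one_pos] with k hk
    calc ‖f k‖ ≤ ‖(C ^ k)ᵀ‖ * ‖S‖ * ‖C ^ k‖ := norm_mul₃_le
      _ = ‖C ^ k‖ * (‖S‖ * ‖C ^ k‖) := by rw [frobenius_norm_transpose]; ring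
      _ ≤ 1 * (‖S‖ * ‖C ^ k‖) := by gcongr
      _ = _ := one_mul _
  have hfsucc (k : ℕ) : f (k + 1) = Cᵀ * f k * C := by
    simp only [hf, pow_succ, transpose_mul, Matrix.mul_assoc]
  have hpsd (k : ℕ) : (f k).PosSemidef := by
    simpa [hf] using hS.posSemidef.conjTranspose_mul_mul_same (C ^ k)
  have heq : ∑' k, f k = S + Cᵀ * (∑' k, f k) * C := by
    conv_lhs => rw [hsum.tsum_eq_zero_add]
    simp only [hfsucc]
    rw [(hsum.mul_left _).tsum_mul_right, hsum.tsum_mul_left]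
    simp [hf]
  have hP : (∑' k, f k).PosSemidef := by
    refine .of_dotProduct_mulVec_nonneg ?_ fun x => ?_
    · rw [IsHermitian, conjTranspose_tsum]
      exact tsum_congr fun k => (hpsd k).1
    · have hx : HasSum (fun k => star x ⬝ᵥ f k *ᵥ x) (star x ⬝ᵥ (∑' k, f k) *ᵥ x) :=
        hsum.hasSum.map (AddMonoidHom.mk' (fun M : Matrix n n ℝ => star x ⬝ᵥ M *ᵥ x)
          fun M N => by simp [add_mulVec, dotProduct_add])
          (show Continuous fun M : Matrix n n ℝ => star x ⬝ᵥ M *ᵥ x by fun_prop)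
      exact hx.nonneg fun k => (hpsd k).dotProduct_mulVec_nonneg x
  refine ⟨∑' k, f k, ?_, ?_⟩
  · rw [heq]
    exact hS.add_posSemidef (by simpa using hP.conjTranspose_mul_mul_same C)
  · exact sub_eq_of_eq_add heq

end Stein

section Lyapunov

variable {n : Type*} [Fintype n] [DecidableEq n]

theorem isUnit_map_ofReal_iff {M : Matrix n n ℝ} :
    IsUnit (M.map ((↑) : ℝ → ℂ)) ↔ IsUnit M := by
  have : (M.map ((↑) : ℝ → ℂ)).det = (M.det : ℂ) := (Complex.ofRealHom.map_det M).symm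
  simp [isUnit_iff_isUnit_det, this]

/-- The Cayley transform maps the open left half plane into the open unit disc. -/
theorem norm_lt_one_of_mem_spectrum_cayley {A C : Matrix n n ℂ}
    (hA : ∀ z ∈ spectrum ℂ A, z.re < 0) (hu : IsUnit (1 - A)) (hC : C * (1 - A) = 1 + A)
    {z : ℂ} (hz : z ∈ spectrum ℂ C) : ‖z‖ < 1 := by
  have hfac : (algebraMap ℂ (Matrix n n ℂ) z - C) * (1 - A)
      = (z - 1) • (1 : Matrix n n ℂ) - (z + 1) • A := by
    rw [sub_mul, hC, Algebra.algebraMap_eq_smul_one]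
    simp only [smul_mul_assoc, one_mul, smul_sub, sub_smul, add_smul, one_smul]
    abel
  have hnot : ¬ IsUnit ((z - 1) • (1 : Matrix n n ℂ) - (z + 1) • A) := by
    rw [← hfac, hu.mul_right_iff]
    exact hz
  have hz1 : z + 1 ≠ 0 := by
    intro h
    apply hnot
    rw [h, zero_smul, sub_zero, eq_neg_of_add_eq_zero_left h]
    exact (isUnit_one (M := Matrix n n ℂ)).smul (Units.mk0 (-1 - 1 : ℂ) (by norm_num))
  have hmem : (z - 1) / (z + 1) ∈ spectrum ℂ A := by
    intro h
    apply hnot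
    convert h.smul (Units.mk0 _ hz1) using 1
    rw [Units.smul_mk0, smul_sub, Algebra.algebraMap_eq_smul_one, smul_smul,
      mul_div_cancel₀ _ hz1]
  have hre := hA _ hmem
  rw [Complex.div_re, ← add_div, div_neg_iff] at hre
  have hpos := Complex.normSq_pos.2 hz1
  have hnum := (hre.resolve_left fun h => absurd h.2 hpos.not_gt).1
  simp only [Complex.sub_re, Complex.add_re, Complex.one_re, Complex.sub_im, Complex.add_im,
    Complex.one_im] at hnum
  rw [← sq_lt_one_iff₀ (norm_nonneg z), ← Complex.normSq_eq_norm_sq, Complex.normSq_apply]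
  linarith

/-- Solvability of the continuous-time Lyapunov equation for a Hurwitz matrix. -/
theorem exists_posDef_lyapunov {A S : Matrix n n ℝ}
    (hA : ∀ z ∈ spectrum ℂ (A.map ((↑) : ℝ → ℂ)), z.re < 0) (hS : S.PosDef) :
    ∃ P : Matrix n n ℝ, P.PosDef ∧ Aᵀ * P + P * A = -S := by
  have hmap_sub : (1 - A).map ((↑) : ℝ → ℂ) = 1 - A.map ((↑) : ℝ → ℂ) := by
    simp [Matrix.map_sub]
  have huC : IsUnit (1 - A.map ((↑) : ℝ → ℂ)) := by
    by_contra h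
    have := hA 1 (by rwa [spectrum.mem_iff, map_one])
    norm_num at this
  have hu : IsUnit (1 - A) := by rwa [← isUnit_map_ofReal_iff, hmap_sub]
  have hdet := (isUnit_iff_isUnit_det _).1 hu
  set D := (1 - A)⁻¹ with hD
  have hDu : IsUnit D := (isUnit_nonsing_inv_iff).2 hu
  have hC : (1 + A) * D * (1 - A) = 1 + A := nonsing_inv_mul_cancel_right _ _ hdet
  have hW : ((2 : ℝ) • (Dᵀ * S * D)).PosDef := by
    refine PosDef.smul ?_ two_pos
    simpa using hS.conjTranspose_mul_mul_same (mulVec_injective_of_isUnit hDu)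
  obtain ⟨P, hP, hPeq⟩ := exists_posDef_sub_transpose_mul_mul_eq (C := (1 + A) * D)
    (fun z hz => norm_lt_one_of_mem_spectrum_cayley hA huC (by
      have hC' := congrArg Complex.ofRealHom.mapMatrix hC
      rw [map_mul, map_add, map_one] at hC'
      rwa [← hmap_sub]) hz) hW
  refine ⟨P, hP, ?_⟩
  have hCt : (1 - A)ᵀ * ((1 + A) * D)ᵀ = (1 + A)ᵀ := by rw [← transpose_mul, hC]
  have hDt : (1 - A)ᵀ * Dᵀ = 1 := by
    rw [← transpose_mul, nonsing_inv_mul _ hdet, transpose_one]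
  have hDm : D * (1 - A) = 1 := nonsing_inv_mul _ hdet
  have key : (1 - A)ᵀ * P * (1 - A) - (1 + A)ᵀ * P * (1 + A) = (2 : ℝ) • S := by
    calc _ = (1 - A)ᵀ * P * (1 - A)
          - ((1 - A)ᵀ * ((1 + A) * D)ᵀ) * P * ((1 + A) * D * (1 - A)) := by rw [hCt, hC]
      _ = (1 - A)ᵀ * (P - ((1 + A) * D)ᵀ * P * ((1 + A) * D)) * (1 - A) := by noncomm_ring
      _ = (2 : ℝ) • (((1 - A)ᵀ * Dᵀ) * S * (D * (1 - A))) := by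
        rw [hPeq]; simp only [mul_smul_comm, smul_mul_assoc, Matrix.mul_assoc]
      _ = (2 : ℝ) • S := by rw [hDt, hDm, one_mul, mul_one]
  have key' : (2 : ℝ) • (Aᵀ * P + P * A) = (2 : ℝ) • (-S) := by
    rw [smul_neg, ← key]
    simp only [transpose_sub, transpose_add, transpose_one, two_smul]
    noncomm_ring
  exact smul_right_injective _ two_ne_zero key'

/-- A strict Lyapunov inequality forces the spectrum into the open left half plane. -/
theorem re_neg_of_posDef_lyapunov {A P : Matrix n n ℝ} (hP : P.PosDef)
    (hL : ∀ x : n → ℝ, x ≠ 0 → x ⬝ᵥ (Aᵀ * P + P * A) *ᵥ x < 0)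
    {z : ℂ} (hz : z ∈ spectrum ℂ (A.map ((↑) : ℝ → ℂ))) : z.re < 0 := by
  rw [spectrum.mem_iff, isUnit_iff_isUnit_det, isUnit_iff_ne_zero, not_not,
    ← exists_mulVec_eq_zero_iff] at hz
  obtain ⟨v, hv, hzv⟩ := hz
  rw [sub_mulVec, sub_eq_zero, Algebra.algebraMap_eq_smul_one, smul_mulVec, one_mulVec] at hzv
  set x : n → ℝ := fun i => (v i).re with hx
  set y : n → ℝ := fun i => (v i).im with hy
  have hAx : A *ᵥ x = z.re • x - z.im • y := by
    ext i
    simpa [mulVec, dotProduct, hx, hy] using (congrArg Complex.re (congrFun hzv i)).symm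
  have hAy : A *ᵥ y = z.re • y + z.im • x := by
    ext i
    simpa [mulVec, dotProduct, hx, hy] using (congrArg Complex.im (congrFun hzv i)).symm
  have hPt : Pᵀ = P := by simpa [IsHermitian] using hP.1
  have hsymm (u w : n → ℝ) : u ⬝ᵥ P *ᵥ w = w ⬝ᵥ P *ᵥ u := by
    rw [dotProduct_mulVec, ← mulVec_transpose, hPt, dotProduct_comm]
  have hquad (u : n → ℝ) : u ⬝ᵥ (Aᵀ * P + P * A) *ᵥ u = 2 * (u ⬝ᵥ P *ᵥ (A *ᵥ u)) := by
    rw [add_mulVec, dotProduct_add, ← mulVec_mulVec, ← mulVec_mulVec, dotProduct_mulVec u Aᵀ,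
      vecMul_transpose, hsymm (A *ᵥ u)]
    ring
  have hsum : x ⬝ᵥ (Aᵀ * P + P * A) *ᵥ x + y ⬝ᵥ (Aᵀ * P + P * A) *ᵥ y
      = 2 * z.re * (x ⬝ᵥ P *ᵥ x + y ⬝ᵥ P *ᵥ y) := by
    rw [hquad, hquad, hAx, hAy]
    simp only [mulVec_sub, mulVec_add, mulVec_smul, dotProduct_sub, dotProduct_add,
      dotProduct_smul, smul_eq_mul, hsymm y x]
    ring
  have hL0 (u : n → ℝ) : u ⬝ᵥ (Aᵀ * P + P * A) *ᵥ u ≤ 0 := by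
    obtain rfl | hu := eq_or_ne u 0
    · simp
    · exact (hL u hu).le
  have hP0 (u : n → ℝ) : 0 ≤ u ⬝ᵥ P *ᵥ u := hP.posSemidef.dotProduct_mulVec_nonneg u
  have hxy : x ≠ 0 ∨ y ≠ 0 := by
    by_contra! h
    exact hv (funext fun i => Complex.ext (congrFun h.1 i) (congrFun h.2 i))
  have hneg : 2 * z.re * (x ⬝ᵥ P *ᵥ x + y ⬝ᵥ P *ᵥ y) < 0 := by
    rw [← hsum]
    rcases hxy with h | h
    · linarith [hL x h, hL0 y]
    · linarith [hL y h, hL0 x]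
  by_contra! hre
  nlinarith [mul_nonneg hre (add_nonneg (hP0 x) (hP0 y))]

end Lyapunov

theorem PosDef.fromBlocks_zero_zero {m n : Type*} [Fintype m] [Fintype n]
    {M : Matrix m m ℝ} {N : Matrix n n ℝ} (hM : M.PosDef) (hN : N.PosDef) :
    (fromBlocks M 0 0 N).PosDef := by
  refine .of_dotProduct_mulVec_pos (hM.1.fromBlocks (by simp) hN.1) fun x hx => ?_
  obtain ⟨u, w, rfl⟩ : ∃ u w, x = Sum.elim u w := ⟨_, _, (Sum.elim_comp_inl_inr x).symm⟩
  have hq : star (Sum.elim u w) ⬝ᵥ fromBlocks M 0 0 N *ᵥ Sum.elim u w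
      = star u ⬝ᵥ M *ᵥ u + star w ⬝ᵥ N *ᵥ w := by
    simp [fromBlocks_mulVec, sumElim_dotProduct_sumElim]
  rw [hq]
  by_cases hu : u = 0
  · have hw : w ≠ 0 := by
      rintro rfl
      exact hx (by simp [hu])
    simpa [hu] using hN.dotProduct_mulVec_pos hw
  · exact add_pos_of_pos_of_nonneg (hM.dotProduct_mulVec_pos hu)
      (hN.posSemidef.dotProduct_mulVec_nonneg w)

end Matrix

/-- The paper's Theorem 5: the LMI (9) admits a solution `(P, P̄)` with `P̄ ≻ 0`
if and only if `A` is Hurwitz. -/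
theorem lmi_solvable_iff_hurwitz
    (n m : ℕ)
    (A : Matrix (Fin n) (Fin n) ℝ) (B : Matrix (Fin n) (Fin m) ℝ)
    (Q : Matrix (Fin n) (Fin n) ℝ) (R : Matrix (Fin m) (Fin m) ℝ)
    (hQ : Q.PosSemidef) (hR : R.PosDef) :
    (∃ (P Pbar : Matrix (Fin n) (Fin n) ℝ), Pbar.PosDef ∧
      (Matrix.fromBlocks (-(Aᵀ * Pbar + Pbar * A + Q))
        ((P + Pᵀ - (2:ℝ) • Pbar) * B)
        (Bᵀ * (P + Pᵀ - (2:ℝ) • Pbar)) ((4:ℝ) • R)).PosDef) ↔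
    (∀ μ ∈ spectrum ℂ (A.map ((↑) : ℝ → ℂ)), μ.re < 0) := by
  constructor
  · rintro ⟨P, Pbar, hPbar, hL⟩ z hz
    refine re_neg_of_posDef_lyapunov hPbar (fun x hx => ?_) hz
    have hM : (-(Aᵀ * Pbar + Pbar * A + Q)).PosDef := hL.submatrix Sum.inl_injective
    have h₁ := hM.dotProduct_mulVec_pos hx
    have h₂ := hQ.dotProduct_mulVec_nonneg x
    simp only [star_trivial, neg_mulVec, dotProduct_neg, add_mulVec, dotProduct_add] at h₁ h₂ ⊢
    linarith
  · intro hA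
    obtain ⟨P, hP, hPeq⟩ := exists_posDef_lyapunov hA (PosDef.one.add_posSemidef hQ)
    refine ⟨P, P, hP, ?_⟩
    have hPt : Pᵀ = P := by simpa [IsHermitian] using hP.1
    have h₀ : P + Pᵀ - (2 : ℝ) • P = 0 := by rw [hPt, two_smul, sub_self]
    have h₁ : -(Aᵀ * P + P * A + Q) = 1 := by rw [hPeq]; abel
    rw [h₀, h₁, Matrix.zero_mul, Matrix.mul_zero]
    exact PosDef.one.fromBlocks_zero_zero (hR.smul four_pos)
end

section
/- Let N ≥ 1 and n ≥ 1 be natural numbers. Let U ∈ ℝ^{N×N} be the upper-triangular matrix of ones, i.e., for i, j ∈ Fin N, U i j = 1 if i ≤ j and U i j = 0 otherwise. Let L ∈ ℝ^{N×N} be such that every row sum of L is zero (∑_j L i j = 0 for each i) and every column sum of L is zero (∑_i L i j = 0 for each j), and let Q ∈ ℝ^{n×n} be arbitrary. Then: (1) the last row and last column of Uᵀ L U are zero, i.e., (Uᵀ L U) (N−1) j = 0 for every j and (Uᵀ L U) i (N−1) = 0 for every i (indices in Fin N, with N−1 the last index); and (2) consequently, the Kronecker product ((Uᵀ L U) ⊗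 Q) ∈ ℝ^{nN×nN}, indexed by pairs (i,a) ∈ Fin N × Fin n, has all entries with first row index equal to N−1 or first column index equal to N−1 equal to zero. -/
open Matrix Kronecker

/-- If the rows of `L` sum to zero and column `k` of `U` is all ones, then column `k` of
`A * L * U` vanishes. -/
theorem mul_mul_apply_eq_zero_of_row_sums {l m n o R : Type*} [Fintype m] [Fintype n]
    [Semiring R] (A : Matrix l m R) {L : Matrix m n R} {U : Matrix n o R} {k : o}
    (hL : ∀ i, ∑ j, L i j = 0) (hU : ∀ j, U j k = 1) (i : l) :
    (A * L * U) i k = 0 := by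
  rw [Matrix.mul_assoc, Matrix.mul_apply]
  refine Finset.sum_eq_zero fun j _ => ?_
  simp [Matrix.mul_apply, hU, hL]

/-- If the columns of `L` sum to zero and row `k` of `U` is all ones, then row `k` of
`U * L * A` vanishes. -/
theorem mul_mul_apply_eq_zero_of_col_sums {l m n o R : Type*} [Fintype m] [Fintype n]
    [Semiring R] {U : Matrix l m R} {L : Matrix m n R} (A : Matrix n o R) {k : l}
    (hL : ∀ j, ∑ i, L i j = 0) (hU : ∀ i, U k i = 1) (j : o) :
    (U * L * A) k j = 0 := by
  rw [Matrix.mul_apply]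
  refine Finset.sum_eq_zero fun i _ => ?_
  simp [Matrix.mul_apply, hU, hL]

/-- Statement 3 of the paper's Theorem 6: the congruence transformation of a
Laplacian-like matrix `L` by the upper-triangular all-ones matrix `U` annihilates
the last row and column, and hence the corresponding blocks of `(Uᵀ L U) ⊗ Q`. -/
theorem laplacian_congruence_last_block_zero
    (N n : ℕ) (hN : 1 ≤ N) (hn : 1 ≤ n)
    (U : Matrix (Fin N) (Fin N) ℝ)
    (hU : ∀ i j : Fin N, U i j = if i ≤ j then 1 else 0)
    (L : Matrix (Fin N) (Fin N) ℝ)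
    (hrow : ∀ i : Fin N, ∑ j, L i j = 0)
    (hcol : ∀ j : Fin N, ∑ i, L i j = 0)
    (Q : Matrix (Fin n) (Fin n) ℝ) :
    ((∀ j : Fin N, (Uᵀ * L * U) ⟨N - 1, by omega⟩ j = 0) ∧
     (∀ i : Fin N, (Uᵀ * L * U) i ⟨N - 1, by omega⟩ = 0)) ∧
    ((∀ (a : Fin n) (j : Fin N) (b : Fin n),
        ((Uᵀ * L * U) ⊗ₖ Q) (⟨N - 1, by omega⟩, a) (j, b) = 0) ∧
     (∀ (i : Fin N) (a b : Fin n),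
        ((Uᵀ * L * U) ⊗ₖ Q) (i, a) (⟨N - 1, by omega⟩, b) = 0)) := by
  have hlast (i : Fin N) : U i ⟨N - 1, by omega⟩ = 1 := by
    rw [hU, if_pos]
    exact Fin.mk_le_mk.mpr (by omega)
  have hlastRow (j : Fin N) : (Uᵀ * L * U) ⟨N - 1, by omega⟩ j = 0 :=
    mul_mul_apply_eq_zero_of_col_sums U hcol hlast j
  have hlastCol (i : Fin N) : (Uᵀ * L * U) i ⟨N - 1, by omega⟩ = 0 :=
    mul_mul_apply_eq_zero_of_row_sums Uᵀ hrow hlast i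
  refine ⟨⟨hlastRow, hlastCol⟩, fun a j b => ?_, fun i a b => ?_⟩
  · rw [kroneckerMap_apply, hlastRow, zero_mul]
  · rw [kroneckerMap_apply, hlastCol, zero_mul]
end

section
/- Let N ≥ 2 and n, m ≥ 1 be natural numbers, let B : Fin N → ℝ^{n×m}, and let R̲ ∈ ℝ^{m×m} be invertible. Define B̃ ∈ ℝ^{(n(N−1)) × (mN)}, indexed by (Fin (N−1) × Fin n) × (Fin N × Fin m), by B̃ ((i,a),(j,c)) = (B j) a c if (j : ℕ) = (i : ℕ), B̃ ((i,a),(j,c)) = −(B j) a c if (j : ℕ) = (i : ℕ) + 1, and B̃ ((i,a),(j,c)) = 0 otherwise. Let R̂ be the block-diagonal matrix indexed by Fin N × Fin m with every diagonal block equal to R̲ (R̂ ((j,c),(j',c')) = R̲ c c' if j = j', else 0). Let P̂, indexed by (Fin (N−1) × Fin n) × (Fin (N−1) × Fin n), be block diagonal, i.e., P̂ ((i,a),(i',a')) = 0 whenever i ≠ i'. Then the matrix K := −R̂⁻¹ B̃ᵀ P̂ satisfies K ((j,c),(i,a)) = 0 whenever (j : ℕ) ≠ (i : ℕ) and (j :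 ℕ) ≠ (i : ℕ) + 1. -/
open Matrix

/-- The paper's Corollary 1: for the line topology, a block-diagonal design matrix
`P̂` yields a feedback gain `K = -R̂⁻¹ B̃ᵀ P̂` with the required sparsity pattern. -/
theorem line_topology_sparsity
    (N n m : ℕ) (hN : 2 ≤ N) (hn : 1 ≤ n) (hm : 1 ≤ m)
    (B : Fin N → Matrix (Fin n) (Fin m) ℝ)
    (Runder : Matrix (Fin m) (Fin m) ℝ) (hR : IsUnit Runder.det)
    (Btil : Matrix (Fin (N - 1) × Fin n) (Fin N × Fin m) ℝ)
    (hBtil1 : ∀ (i : Fin (N - 1)) (a : Fin n) (j : Fin N) (c : Fin m),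
      (j : ℕ) = (i : ℕ) → Btil (i, a) (j, c) = B j a c)
    (hBtil2 : ∀ (i : Fin (N - 1)) (a : Fin n) (j : Fin N) (c : Fin m),
      (j : ℕ) = (i : ℕ) + 1 → Btil (i, a) (j, c) = -(B j a c))
    (hBtil3 : ∀ (i : Fin (N - 1)) (a : Fin n) (j : Fin N) (c : Fin m),
      (j : ℕ) ≠ (i : ℕ) → (j : ℕ) ≠ (i : ℕ) + 1 → Btil (i, a) (j, c) = 0)
    (Rhat : Matrix (Fin N × Fin m) (Fin N × Fin m) ℝ)
    (hRhat : ∀ (j : Fin N) (c : Fin m) (j' : Fin N) (c' : Fin m),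
      Rhat (j, c) (j', c') = if j = j' then Runder c c' else 0)
    (Phat : Matrix (Fin (N - 1) × Fin n) (Fin (N - 1) × Fin n) ℝ)
    (hPhat : ∀ (i : Fin (N - 1)) (a : Fin n) (i' : Fin (N - 1)) (a' : Fin n),
      i ≠ i' → Phat (i, a) (i', a') = 0)
    (K : Matrix (Fin N × Fin m) (Fin (N - 1) × Fin n) ℝ)
    (hK : K = -(Rhat⁻¹ * Btilᵀ * Phat)) :
    ∀ (j : Fin N) (c : Fin m) (i : Fin (N - 1)) (a : Fin n),
      (j : ℕ) ≠ (i : ℕ) → (j : ℕ) ≠ (i : ℕ) + 1 → K (j, c) (i, a) = 0 := by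
  intro j c i a h0 h1
  have hRinv : Rhat⁻¹ = kroneckerMap (· * ·) 1 Runder⁻¹ := by
    have hRkron : Rhat = kroneckerMap (· * ·) 1 Runder := by
      ext ⟨j, c⟩ ⟨j', c'⟩
      simp [hRhat, one_apply]
    rw [hRkron, inv_kronecker, inv_one]
  rw [hK, neg_apply, neg_eq_zero, mul_apply]
  refine Finset.sum_eq_zero fun ⟨i', a'⟩ _ => ?_
  by_cases hi : i' = i
  · subst hi
    rw [mul_apply, Finset.sum_eq_zero, zero_mul]
    rintro ⟨j', c'⟩ -
    by_cases hj : j = j'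
    · subst hj
      rw [transpose_apply, hBtil3 i' a' j c' h0 h1, mul_zero]
    · simp [hRinv, hj]
  · rw [hPhat i' a' i a hi, mul_zero]
end
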